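/- Let c : ℕ → ℂ be a higher order oscillating sequence of order 2 (stronger version). Let A ∈ GL(2, ℤ), a ∈ 𝕋² = ℝ²/ℤ², and let T : 𝕋² → 𝕋² be the affine map T(x) = Ax + a. If the topological entropy of T is zero, then c is linearly disjoint from T: for every continuous function f : 𝕋² → ℂ and every x ∈ 𝕋², (1/N) ∑_{n=1}^{N} c_n · f(Tⁿ x) → 0 as N → ∞. -/

import Mathlib

open Filter Polynomial

noncomputable section

/-- The `d`-torus `ℝ^d/ℤ^d`, as a product of copies of `ℝ/ℤ`. -/
abbrev Torus (d : ℕ) := Fin d → AddCircle (1 : ℝ)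

/-- The affine map `x ↦ A x + a` on the `d`-torus, for an integer matrix `A`. -/
def torusAffine {d : ℕ} (A : Matrix (Fin d) (Fin d) ℤ) (a : Torus d) (x : Torus d) : Torus d :=
  fun i => (∑ j, A i j • x j) + a i

/-- `c` is a higher order oscillating sequence of order `m` (stronger version): for some
`λ > 1` the averages of `|c n|^λ` converge to a finite limit, and for every real-coefficient
polynomial `P` of degree at most `m` the averages of `c n · e^{2πi P(n)}` tend to `0`. -/
def HigherOrderOscillating (c : ℕ → ℂ) (m : ℕ) : Prop :=
  (∃ lam : ℝ, 1 < lam ∧ ∃ K : ℝ,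
    Tendsto (fun N : ℕ => (1 / N : ℝ) * ∑ n ∈ Finset.Icc 1 N, ‖c n‖ ^ lam) atTop (nhds K)) ∧
  ∀ P : Polynomial ℝ, P.degree ≤ m →
    Tendsto (fun N : ℕ => (1 / N : ℂ) * ∑ n ∈ Finset.Icc 1 N,
      c n * Complex.exp (2 * Real.pi * Complex.I * (P.eval (n : ℝ)))) atTop (nhds 0)

/-- `c` is linearly disjoint from the flow `T`: for every continuous `f : X → ℂ` and every
`x ∈ X`, `(1/N) ∑_{n=1}^N c n · f(Tⁿ x) → 0` as `N → ∞`. -/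
def LinearlyDisjoint {X : Type*} [TopologicalSpace X] (c : ℕ → ℂ) (T : X → X) : Prop :=
  ∀ f : X → ℂ, Continuous f → ∀ x : X,
    Tendsto (fun N : ℕ => (1 / N : ℂ) * ∑ n ∈ Finset.Icc 1 N, c n * f (T^[n] x)) atTop (nhds 0)

lemma sep_aux (μ τ : ℝ) (hμ : 1 < |μ|) (hτ : |τ| ≤ 1 / 2) (n : ℕ)
    (h : 1 / (2 * |μ|) ≤ |τ| * |μ| ^ n) :
    ∃ k ≤ n, 1 / (2 * |μ|) ≤ ‖((τ * μ ^ k : ℝ) : AddCircle (1 : ℝ))‖ := by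
  induction n with
  | zero =>
    refine ⟨0, le_rfl, ?_⟩
    rw [(AddCircle.norm_coe_eq_abs_iff (p := (1:ℝ)) one_ne_zero).2]
    · simpa using h
    · simpa using hτ
  | succ n ih =>
    by_cases h' : 1 / (2 * |μ|) ≤ |τ| * |μ| ^ n
    · obtain ⟨k, hk, h2⟩ := ih h'
      exact ⟨k, by omega, h2⟩
    · push Not at h'
      refine ⟨n + 1, le_rfl, ?_⟩
      rw [(AddCircle.norm_coe_eq_abs_iff (p := (1:ℝ)) one_ne_zero).2]
      · rw [abs_mul, abs_pow]; exact h
      · rw [abs_mul, abs_pow, abs_one, pow_succ, ← mul_assoc]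
        have h0 : 0 < |μ| := by linarith
        have := mul_le_mul_of_nonneg_right h'.le h0.le
        refine this.trans (le_of_eq ?_)
        field_simp

lemma iter_aux (A : Matrix (Fin 2) (Fin 2) ℤ) (a : Torus 2) (μ : ℝ) (v : Fin 2 → ℝ)
    (hv : ∀ i, ∑ j, (A i j : ℝ) * v j = μ * v i) (t s : ℝ) (n : ℕ) (i : Fin 2) :
    ((torusAffine A a)^[n] (fun i => ((t * v i : ℝ) : AddCircle (1:ℝ)))) i -
    ((torusAffine A a)^[n] (fun i => ((s * v i : ℝ) : AddCircle (1:ℝ)))) i =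
      (((t - s) * μ ^ n * v i : ℝ) : AddCircle (1:ℝ)) := by
  induction n generalizing i with
  | zero => simp [sub_mul]
  | succ n ih =>
    rw [Function.iterate_succ_apply', Function.iterate_succ_apply']
    set X := ((torusAffine A a)^[n] (fun i => ((t * v i : ℝ) : AddCircle (1:ℝ))))
    set Y := ((torusAffine A a)^[n] (fun i => ((s * v i : ℝ) : AddCircle (1:ℝ))))
    have : torusAffine A a X i - torusAffine A a Y i = ∑ j, A i j • (X j - Y j) := by
      simp only [torusAffine, smul_sub, Finset.sum_sub_distrib]
      abel
    rw [this]
    simp only [ih]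
    have h2 : (t - s) * μ ^ (n+1) * v i = ∑ j, A i j • ((t - s) * μ ^ n * v j) := by
      have := hv i
      simp only [Fin.sum_univ_two, zsmul_eq_mul] at this ⊢
      linear_combination (-(t - s) * μ ^ n) * this
    rw [h2]
    simp [Fin.sum_univ_two]

open Dynamics in
lemma entropy_pos (A : Matrix (Fin 2) (Fin 2) ℤ) (a : Torus 2) (μ : ℝ) (v : Fin 2 → ℝ)
    (hv : ∀ i, ∑ j, (A i j : ℝ) * v j = μ * v i) (hv0 : v 0 = 1) (hμ : 1 < |μ|) :
    0 < coverEntropy (torusAffine A a) Set.univ := by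
  have h0 : 0 < |μ| := by linarith
  set δ : ℝ := 1 / (2 * |μ|) with hδ
  have hδ0 : 0 < δ := by positivity
  set U : SetRel (Torus 2) (Torus 2) := {p | dist p.1 p.2 < δ / 2} with hU
  have hUu : U ∈ uniformity (Torus 2) := Metric.dist_mem_uniformity (by positivity)
  refine lt_of_lt_of_le ?_ (netEntropyEntourage_le_coverEntropy _ _ hUu)
  have key : ∀ n : ℕ, ENNReal.ofReal |μ| ^ (n+1) ≤
      (netMaxcard (torusAffine A a) Set.univ U (n+1) : ENNReal) := by
    intro n
    set x : ℝ → Torus 2 := fun t i => ((t * v i : ℝ) : AddCircle (1:ℝ)) with hx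
    set g : ℕ → ℝ := fun j => j * δ / |μ| ^ n with hg
    set M := ⌊|μ| ^ (n+1)⌋₊ with hM
    have sep : ∀ j ∈ Finset.range (M+1), ∀ k ∈ Finset.range (M+1), j ≠ k →
        ∃ m ≤ n, δ ≤ dist ((torusAffine A a)^[m] (x (g j))) ((torusAffine A a)^[m] (x (g k))) := by
      intro j hj k hk hjk
      have hMle : (M : ℝ) ≤ |μ| ^ (n+1) := Nat.floor_le (by positivity)
      have hjM : (j : ℝ) ≤ M := by
        have := Finset.mem_range.1 hj
        exact_mod_cast (by omega : j ≤ M)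
      have hkM : (k : ℝ) ≤ M := by
        have := Finset.mem_range.1 hk
        exact_mod_cast (by omega : k ≤ M)
      have e : g j - g k = ((j : ℝ) - k) * (δ / |μ| ^ n) := by simp only [hg]; ring
      have hd : 0 < δ / |μ| ^ n := by positivity
      obtain ⟨m, hm, h⟩ := sep_aux μ (g j - g k) hμ (by
        rw [e, abs_mul, abs_of_pos hd]
        have : |(j:ℝ) - k| ≤ |μ| ^ (n+1) := by
          have h1 : (0:ℝ) ≤ j := by positivity
          have h2 : (0:ℝ) ≤ k := by positivity
          rw [abs_le]; constructor <;> linarith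
        refine (mul_le_mul_of_nonneg_right this hd.le).trans (le_of_eq ?_)
        rw [hδ]; field_simp; ring) n (by
        rw [e, abs_mul, abs_of_pos hd]
        have : 1 ≤ |(j:ℝ) - k| := by
          have : (1:ℤ) ≤ |(j:ℤ) - k| := Int.one_le_abs (by omega)
          exact_mod_cast this
        have h3 : |(j:ℝ) - k| * (δ / |μ| ^ n) * |μ| ^ n = |(j:ℝ) - k| * δ := by field_simp
        rw [h3]
        nlinarith)
      refine ⟨m, hm, ?_⟩
      refine le_trans ?_ (dist_le_pi_dist _ _ 0)
      rw [dist_eq_norm, hx, iter_aux A a μ v hv, hv0, mul_one]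
      exact h
    classical
    have net : IsDynNetIn (torusAffine A a) Set.univ U (n+1)
        ((Finset.range (M+1)).image (fun j => x (g j)) : Finset (Torus 2)) := by
      refine ⟨Set.subset_univ _, ?_⟩
      intro p hp q hq hpq
      simp only [Finset.coe_image, Set.mem_image, Finset.mem_coe] at hp hq
      obtain ⟨j, hj, rfl⟩ := hp
      obtain ⟨k, hk, rfl⟩ := hq
      obtain ⟨m, hm, h⟩ := sep j hj k hk (by rintro rfl; exact hpq rfl)
      refine Set.disjoint_left.2 ?_
      intro z hz1 hz2
      rw [mem_ball_dynEntourage] at hz1 hz2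
      have h1 := hz1 m (by omega)
      have h2 := hz2 m (by omega)
      simp only [UniformSpace.ball, hU, Set.mem_preimage, Set.mem_ofPred_eq] at h1 h2
      have := dist_triangle_right ((torusAffine A a)^[m] (x (g j))) ((torusAffine A a)^[m] (x (g k))) ((torusAffine A a)^[m] z)
      linarith
    have hcard : ((Finset.range (M+1)).image (fun j => x (g j)) : Finset (Torus 2)).card = M + 1 := by
      rw [Finset.card_image_of_injOn, Finset.card_range]
      intro j hj k hk hjk
      by_contra hne
      obtain ⟨m, hm, h⟩ := sep j hj k hk hne
      simp only at hjk
      rw [hjk, dist_self] at h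
      linarith
    have h1 := net.card_le_netMaxcard
    rw [hcard] at h1
    have h2 := ENat.toENNReal_mono h1
    refine le_trans ?_ h2
    rw [← ENNReal.ofReal_pow h0.le]
    refine ENNReal.ofReal_le_of_le_toReal ?_
    have h5 : (((M + 1 : ℕ) : ℕ∞) : ENNReal).toReal = (M : ℝ) + 1 := by
      rw [ENat.toENNReal_coe, ENNReal.toReal_natCast]; push_cast; rfl
    exact (Nat.lt_floor_add_one (|μ| ^ (n+1))).le.trans h5.ge
  have h1 : ExpGrowth.expGrowthSup (fun n => ENNReal.ofReal |μ| ^ n) ≤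
      netEntropyEntourage (torusAffine A a) Set.univ U := by
    refine ExpGrowth.expGrowthSup_eventually_monotone ?_
    filter_upwards [eventually_ge_atTop 1] with n hn
    obtain ⟨k, rfl⟩ : ∃ k, n = k + 1 := ⟨n - 1, by omega⟩
    exact key k
  refine lt_of_lt_of_le ?_ h1
  rw [ExpGrowth.expGrowthSup_pow]
  rw [ENNReal.zero_lt_log_iff]
  simpa using hμ

lemma char_of_entropy (A : Matrix (Fin 2) (Fin 2) ℤ) (hA : IsUnit A.det) (a : Torus 2)
    (hEnt : Dynamics.coverEntropy (torusAffine A a) Set.univ = 0) :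
    (A ^ 12 - 1) ^ 2 = 0 := by
  have hch : A ^ 2 = A.trace • A - A.det • (1 : Matrix (Fin 2) (Fin 2) ℤ) := by
    have h := Matrix.aeval_self_charpoly A
    rw [Matrix.charpoly_fin_two] at h
    simp only [map_add, map_sub, map_mul, map_pow, Polynomial.aeval_X, Polynomial.aeval_C] at h
    rw [Algebra.algebraMap_eq_smul_one, Algebra.algebraMap_eq_smul_one, smul_mul_assoc,
      one_mul] at h
    rw [← sub_eq_zero, ← h]; abel
  have hcase : (A.det = 1 ∧ |A.trace| ≤ 2) ∨ (A.det = -1 ∧ A.trace = 0) := by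
    by_contra hcon
    have hdet : A.det = 1 ∨ A.det = -1 := Int.isUnit_iff.1 hA
    set T : ℝ := (A.trace : ℝ) with hT
    set D : ℝ := (A.det : ℝ) with hD
    -- bigger root
    obtain ⟨μ, hμ, hroot⟩ : ∃ μ : ℝ, 1 < |μ| ∧ μ ^ 2 - T * μ + D = 0 := by
      have hdisc : 0 < T ^ 2 - 4 * D ∧ 2 < |T| + Real.sqrt (T ^ 2 - 4 * D) := by
        rcases hdet with h | h
        · have h3 : 2 < |A.trace| := by
            by_contra h3; exact hcon (Or.inl ⟨h, not_lt.1 h3⟩)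
          have h3' : (2 : ℝ) < |T| := by rw [hT]; exact_mod_cast h3
          have hD1 : D = 1 := by rw [hD, h]; simp
          refine ⟨by rw [← sq_abs]; nlinarith, ?_⟩
          have := Real.sqrt_nonneg (T ^ 2 - 4 * D)
          linarith
        · have h3 : A.trace ≠ 0 := fun h3 => hcon (Or.inr ⟨h, h3⟩)
          have h3' : (1 : ℝ) ≤ |T| := by rw [hT]; exact_mod_cast Int.one_le_abs h3
          have hD1 : D = -1 := by rw [hD, h]; simp
          refine ⟨by rw [hD1]; nlinarith [sq_nonneg T], ?_⟩
          have : (2:ℝ) ≤ Real.sqrt (T ^ 2 - 4 * D) := by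
            apply Real.le_sqrt_of_sq_le; rw [hD1]; nlinarith [sq_nonneg T]
          linarith
      obtain ⟨hd, h2⟩ := hdisc
      have hs := Real.sq_sqrt hd.le
      set S := Real.sqrt (T ^ 2 - 4 * D)
      have hS0 : 0 ≤ S := Real.sqrt_nonneg _
      rcases le_total 0 T with hT0 | hT0
      · refine ⟨(T + S) / 2, ?_, by linear_combination hs / 4⟩
        rw [abs_of_nonneg hT0] at h2
        rw [lt_abs]; left; linarith
      · refine ⟨(T - S) / 2, ?_, by linear_combination hs / 4⟩
        rw [abs_of_nonpos hT0] at h2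
        rw [lt_abs]; right; linarith
    have hT' : T = A 0 0 + A 1 1 := by simp [hT, Matrix.trace, Fin.sum_univ_two]
    have hD' : D = A 0 0 * A 1 1 - A 0 1 * A 1 0 := by simp [hD, Matrix.det_fin_two]
    have hq : (A 0 1 : ℝ) ≠ 0 := by
      intro hq
      have hq' : A 0 1 = 0 := by exact_mod_cast hq
      have hf : (μ - A 0 0) * (μ - A 1 1) = 0 := by
        rw [hT', hD', hq] at hroot; linear_combination hroot
      have hu : IsUnit (A 0 0 * A 1 1) := by
        have : A.det = A 0 0 * A 1 1 := by rw [Matrix.det_fin_two, hq']; ring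
        rwa [← this]
      have h0 := Int.isUnit_iff_abs_eq.1 (isUnit_of_mul_isUnit_left hu)
      have h1 := Int.isUnit_iff_abs_eq.1 (isUnit_of_mul_isUnit_right hu)
      have h0' : |(A 0 0 : ℝ)| = 1 := by exact_mod_cast h0
      have h1' : |(A 1 1 : ℝ)| = 1 := by exact_mod_cast h1
      rcases mul_eq_zero.1 hf with h | h
      · rw [sub_eq_zero.1 h] at hμ; linarith
      · rw [sub_eq_zero.1 h] at hμ; linarith
    have := entropy_pos A a μ ![1, (μ - A 0 0) / A 0 1] (by
      intro i
      fin_cases i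
      · simp [Fin.sum_univ_two]; field_simp; ring
      · simp [Fin.sum_univ_two]; field_simp
        rw [hT', hD'] at hroot
        linear_combination -hroot) (by simp) hμ
    exact absurd hEnt this.ne'
  have cube : A ^ 3 = A * A^2 := by rw [pow_succ' A 2]
  rcases hcase with ⟨hd, ht⟩ | ⟨hd, ht⟩
  · rw [hd, one_smul] at hch
    obtain ⟨h1, h2⟩ := abs_le.1 ht
    set t := A.trace
    interval_cases t
    · -- trace -2
      have hn : A ^ 2 = -2 * A - 1 := by rw [hch]; simp
      have h : (A + 1) ^ 2 = 0 := by
        have : (A + 1) ^ 2 = A ^ 2 + 2 * A + 1 := by noncomm_ring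
        rw [this, hn]; noncomm_ring
      have : (A ^ 12 - 1) ^ 2 = (A + 1) ^ 2 * ((A-1) * (A^10 + A^8 + A^6 + A^4 + A^2 + 1)) ^ 2 := by
        noncomm_ring
      rw [this, h, zero_mul]
    · have h : A ^ 3 = 1 := by
        have : A ^ 3 - 1 = (A - 1) * (A ^ 2 + A + 1) := by noncomm_ring
        rw [← sub_eq_zero, this, hch]; noncomm_ring
      have : A ^ 12 = (A ^ 3) ^ 4 := by rw [← pow_mul]
      rw [this, h]; simp
    · have h : A ^ 2 = -1 := by rw [hch]; simp
      have : A ^ 12 = (A ^ 2) ^ 6 := by rw [← pow_mul]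
      rw [this, h, Even.neg_one_pow (by decide)]; simp
    · have h : A ^ 3 = -1 := by
        have : A ^ 3 - -1 = (A + 1) * (A ^ 2 - A + 1) := by noncomm_ring
        rw [← sub_eq_zero, this, hch]; noncomm_ring
      have : A ^ 12 = (A ^ 3) ^ 4 := by rw [← pow_mul]
      rw [this, h, Even.neg_one_pow (by decide)]; simp
    · have hn : A ^ 2 = 2 * A - 1 := by rw [hch]; simp
      have h : (A - 1) ^ 2 = 0 := by
        have : (A - 1) ^ 2 = A ^ 2 - 2 * A + 1 := by noncomm_ring
        rw [this, hn]; noncomm_ring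
      have : (A ^ 12 - 1) ^ 2 = (A - 1) ^ 2 * ((A+1) * (A^10 + A^8 + A^6 + A^4 + A^2 + 1)) ^ 2 := by
        noncomm_ring
      rw [this, h, zero_mul]
  · have h : A ^ 2 = 1 := by rw [hch, ht, hd]; simp
    have : A ^ 12 = (A ^ 2) ^ 6 := by rw [← pow_mul]
    rw [this, h]; simp

/-- averages of `c n * g n` tend to zero -/
def AvgZero (c g : ℕ → ℂ) : Prop :=
  Tendsto (fun N : ℕ => (1 / N : ℂ) * ∑ n ∈ Finset.Icc 1 N, c n * g n) atTop (nhds 0)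

lemma AvgZero.const_mul {c g : ℕ → ℂ} (h : AvgZero c g) (k : ℂ) :
    AvgZero c (fun n => k * g n) := by
  have := Tendsto.const_mul k h
  rw [mul_zero] at this
  refine this.congr fun N => ?_
  simp only [Finset.mul_sum]
  exact Finset.sum_congr rfl fun n _ => by ring

lemma AvgZero.add {c g g' : ℕ → ℂ} (h : AvgZero c g) (h' : AvgZero c g') :
    AvgZero c (fun n => g n + g' n) := by
  have := Tendsto.add h h'
  rw [add_zero] at this
  refine this.congr fun N => ?_
  rw [← mul_add, ← Finset.sum_add_distrib]
  simp only [mul_add]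

lemma AvgZero.zero {c : ℕ → ℂ} : AvgZero c (fun _ => 0) := by
  simp [AvgZero]

lemma AvgZero.sum {c : ℕ → ℂ} {ι : Type*} (s : Finset ι) (g : ι → ℕ → ℂ)
    (h : ∀ i ∈ s, AvgZero c (g i)) : AvgZero c (fun n => ∑ i ∈ s, g i n) := by
  classical
  induction s using Finset.induction_on with
  | empty => simpa using AvgZero.zero
  | insert i s hi ih =>
    simp only [Finset.sum_insert hi]
    exact (h i (by simp)).add (ih fun j hj => h j (by simp [hj]))

lemma geom_aux (n r : ℕ) (hr : r < 12) :
    ∑ j ∈ Finset.range 12, Complex.exp (2 * Real.pi * Complex.I * ((j * ((n - r) / 12) : ℝ) : ℂ))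
      = if n % 12 = r then 12 else 0 := by
  set z := Complex.exp (2 * Real.pi * Complex.I * (((n : ℂ) - r) / 12)) with hz
  have hterm : ∀ j : ℕ, Complex.exp (2 * Real.pi * Complex.I * ((j * ((n - r) / 12) : ℝ) : ℂ)) =
      z ^ j := by
    intro j
    rw [hz, ← Complex.exp_nat_mul]
    congr 1
    push_cast
    ring
  simp only [hterm]
  have hz12 : z ^ 12 = 1 := by
    rw [hz, ← Complex.exp_nat_mul, Complex.exp_eq_one_iff]
    refine ⟨(n : ℤ) - r, ?_⟩
    push_cast
    ring
  split_ifs with h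
  · have : z = 1 := by
      rw [hz, Complex.exp_eq_one_iff]
      refine ⟨(n / 12 : ℕ), ?_⟩
      have h2 : (n : ℂ) = 12 * (n / 12 : ℕ) + r := by
        have := Nat.div_add_mod n 12
        rw [h] at this
        exact_mod_cast this.symm
      rw [h2, Int.cast_natCast]
      ring
    simp [this]
  · have hz1 : z ≠ 1 := by
      intro hz1
      rw [hz, Complex.exp_eq_one_iff] at hz1
      obtain ⟨k, hk⟩ := hz1
      have hpi := Complex.two_pi_I_ne_zero
      have h3 : ((n : ℂ) - r) / 12 = k := by
        apply mul_left_cancel₀ hpi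
        rw [hk]; ring
      have h4 : (n : ℂ) - r = 12 * k := by
        rw [← h3]; ring
      have h5 : (n : ℤ) - r = 12 * k := by exact_mod_cast h4
      omega
    have := geom_sum_eq hz1 12
    rw [this, hz12]; simp

lemma osc_aux (c : ℕ → ℂ) (hc : HigherOrderOscillating c 2) (g : ℕ → ℂ)
    (P : ℕ → Polynomial ℝ) (hP : ∀ r, (P r).degree ≤ 2)
    (hg : ∀ n, g n = Complex.exp (2 * Real.pi * Complex.I * ((P (n % 12)).eval (n : ℝ)))) :
    AvgZero c g := by
  have key : g = fun n => ∑ r ∈ Finset.range 12, ∑ j ∈ Finset.range 12, (1 / 12 : ℂ) *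
      Complex.exp (2 * Real.pi * Complex.I *
        ((P r + C (j : ℝ) * (C (1/12) * (X - C (r : ℝ)))).eval (n : ℝ) : ℝ)) := by
    funext n
    have : ∀ r ∈ Finset.range 12, ∑ j ∈ Finset.range 12, (1 / 12 : ℂ) *
      Complex.exp (2 * Real.pi * Complex.I *
        ((P r + C (j : ℝ) * (C (1/12) * (X - C (r : ℝ)))).eval (n : ℝ) : ℝ)) =
        if n % 12 = r then Complex.exp (2 * Real.pi * Complex.I * ((P r).eval (n : ℝ))) else 0 := by
      intro r hr
      have h1 := geom_aux n r (Finset.mem_range.1 hr)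
      have h2 : ∀ j : ℕ, (1 / 12 : ℂ) *
        Complex.exp (2 * Real.pi * Complex.I *
        ((P r + C (j : ℝ) * (C (1/12) * (X - C (r : ℝ)))).eval (n : ℝ) : ℝ)) =
        (1 / 12 : ℂ) * Complex.exp (2 * Real.pi * Complex.I * ((P r).eval (n : ℝ))) *
         Complex.exp (2 * Real.pi * Complex.I * ((j * ((n - r) / 12) : ℝ) : ℂ)) := by
        intro j
        rw [mul_assoc (1 / 12 : ℂ), ← Complex.exp_add]
        congr 2
        simp only [eval_add, eval_mul, eval_C, eval_sub, eval_X]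
        push_cast
        ring
      simp only [h2]
      rw [← Finset.mul_sum, h1]
      split_ifs
      · ring
      · simp
    rw [Finset.sum_congr rfl this, Finset.sum_ite_eq, if_pos (by simp; omega), hg]
  rw [key]
  refine AvgZero.sum _ _ fun r _ => AvgZero.sum _ _ fun j _ => AvgZero.const_mul ?_ _
  refine hc.2 _ ?_
  refine (degree_add_le _ _).trans (max_le (hP r) ?_)
  have : (C (j : ℝ) * (C (1/12) * (X - C (r : ℝ)))).degree ≤ 1 := by compute_degree
  exact this.trans (by norm_num)

/-- linear action on torus -/
def act (B : Matrix (Fin 2) (Fin 2) ℤ) (y : Torus 2) : Torus 2 := fun i => ∑ j, B i j • y j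

lemma act_add (B : Matrix (Fin 2) (Fin 2) ℤ) (y z : Torus 2) :
    act B (y + z) = act B y + act B z := by
  funext i; simp [act, Fin.sum_univ_two]; abel

lemma act_nsmul (B : Matrix (Fin 2) (Fin 2) ℤ) (m : ℕ) (y : Torus 2) :
    act B (m • y) = m • act B y := by
  funext i
  simp only [act, Fin.sum_univ_two, Pi.smul_apply, smul_add]
  rw [smul_comm (B i 0) m, smul_comm (B i 1) m]

lemma act_mul (B D : Matrix (Fin 2) (Fin 2) ℤ) (y : Torus 2) :
    act (B * D) y = act B (act D y) := by
  funext i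
  simp only [act, Matrix.mul_apply, Fin.sum_univ_two, add_smul, mul_smul, smul_add]
  abel

lemma add_act (B D : Matrix (Fin 2) (Fin 2) ℤ) (y : Torus 2) :
    act (B + D) y = act B y + act D y := by
  funext i
  simp only [act, Matrix.add_apply, Fin.sum_univ_two, add_smul, Pi.add_apply]
  abel

lemma one_act (y : Torus 2) : act 1 y = y := by
  funext i
  simp [act, Matrix.one_apply, ite_smul]

lemma affine_add (A : Matrix (Fin 2) (Fin 2) ℤ) (a y h : Torus 2) (n : ℕ) :
    (torusAffine A a)^[n] (y + h) = (torusAffine A a)^[n] y + act (A ^ n) h := by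
  induction n with
  | zero => simp [one_act]
  | succ n ih =>
    rw [Function.iterate_succ_apply', Function.iterate_succ_apply', ih, pow_succ', act_mul]
    have : ∀ z, torusAffine A a z = act A z + a := fun z => rfl
    rw [this, this, act_add]; abel

lemma orbit_aux (A : Matrix (Fin 2) (Fin 2) ℤ) (hA : (A ^ 12 - 1) ^ 2 = 0) (a y : Torus 2) :
    ∃ d e : Torus 2, ∀ m : ℕ, (torusAffine A a)^[12 * m] y = y + m • d + (m.choose 2) • e := by
  set d : Torus 2 := (torusAffine A a)^[12] y - y with hd
  set e : Torus 2 := act (A ^ 12 - 1) d with he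
  have hBd : act (A ^ 12) d = d + e := by
    have : A ^ 12 = 1 + (A ^ 12 - 1) := by abel
    rw [this, add_act, one_act, he]
  have hBe : act (A ^ 12) e = e := by
    have : A ^ 12 = 1 + (A ^ 12 - 1) := by abel
    rw [this, add_act, one_act, he, ← act_mul, ← pow_two, hA]
    have : act 0 d = 0 := by funext i; simp [act]
    rw [this, add_zero]
  refine ⟨d, e, fun m => ?_⟩
  induction m with
  | zero => simp
  | succ m ih =>
    have : 12 * (m + 1) = 12 + 12 * m := by ring
    rw [this, Function.iterate_add_apply, ih, add_assoc, affine_add, act_add, act_nsmul, act_nsmul,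
      hBd, hBe]
    have h1 : (torusAffine A a)^[12] y = y + d := by rw [hd]; abel
    have h2 : (m + 1).choose 2 = m + m.choose 2 := by simp [Nat.choose_succ_succ' m 1]
    rw [h1, h2, add_smul, add_smul, smul_add, one_smul]
    abel

lemma lift_aux (k : Fin 2 → ℤ) (y : Torus 2) : ∃ α : ℝ, ∑ i, k i • y i = ((α : ℝ) : AddCircle (1:ℝ)) := by
  obtain ⟨α, h⟩ := QuotientAddGroup.mk_surjective (∑ i, k i • y i)
  exact ⟨α, h.symm⟩

lemma mFourier_aux (k : Fin 2 → ℤ) (y : Torus 2) (α : ℝ)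
    (h : ∑ i, k i • y i = ((α : ℝ) : AddCircle (1:ℝ))) :
    UnitAddTorus.mFourier k y = Complex.exp (2 * Real.pi * Complex.I * α) := by
  have h1 : UnitAddTorus.mFourier k y = fourier 1 (∑ i, k i • y i) := by
    simp [UnitAddTorus.mFourier, Fin.sum_univ_two, Fin.prod_univ_two, fourier_apply,
      AddCircle.toCircle_add]
  rw [h1, h, fourier_coe_apply]
  simp

lemma char_avg (c : ℕ → ℂ) (hc : HigherOrderOscillating c 2)
    (A : Matrix (Fin 2) (Fin 2) ℤ) (hA : (A ^ 12 - 1) ^ 2 = 0) (a x : Torus 2) (k : Fin 2 → ℤ) :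
    AvgZero c (fun n => UnitAddTorus.mFourier k ((torusAffine A a)^[n] x)) := by
  choose d e hde using fun r : ℕ => orbit_aux A hA a ((torusAffine A a)^[r] x)
  choose φ hφ using lift_aux k
  refine osc_aux c hc _ (fun r => C (φ ((torusAffine A a)^[r] x)) +
    C (φ (d r)) * (C (1/12) * (X - C (r : ℝ))) +
    C (φ (e r) / 2) * ((C (1/12) * (X - C (r : ℝ))) * (C (1/12) * (X - C (r : ℝ)) - 1))) ?_ ?_
  · intro r
    compute_degree
  · intro n
    apply mFourier_aux
    set r := n % 12 with hr
    set m := n / 12 with hm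
    have hn : n = 12 * m + r := by omega
    have h1 := hde r m
    rw [← Function.iterate_add_apply, ← hn] at h1
    have h2 : ((1/12 : ℝ) * (n - r)) = m := by rw [hn]; push_cast; ring
    simp only [eval_add, eval_mul, eval_sub, eval_C, eval_X, eval_one, h2]
    have h3 : φ (e r) / 2 * ((m : ℝ) * (m - 1)) = m.choose 2 • φ (e r) := by
      rw [nsmul_eq_mul, Nat.cast_choose_two]; ring
    rw [h3, h1, ← nsmul_eq_mul' ]
    rw [AddCircle.coe_add, AddCircle.coe_add, AddCircle.coe_nsmul, AddCircle.coe_nsmul,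
      ← hφ, ← hφ, ← hφ]
    simp only [Fin.sum_univ_two, Pi.add_apply, Pi.smul_apply, smul_add]
    rw [smul_comm (k 0) m, smul_comm (k 1) m, smul_comm (k 0) (m.choose 2),
      smul_comm (k 1) (m.choose 2)]
    abel

lemma bdd_aux (c : ℕ → ℂ) (hc : HigherOrderOscillating c 2) :
    ∃ M : ℝ, 0 < M ∧ ∀ N : ℕ, (1 / N : ℝ) * ∑ n ∈ Finset.Icc 1 N, ‖c n‖ ≤ M := by
  obtain ⟨⟨lam, hl, K, hK⟩, -⟩ := hc
  obtain ⟨B, hB⟩ := hK.bddAbove_range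
  refine ⟨max B 0 + 1, by positivity, fun N => ?_⟩
  have hBN : (1 / N : ℝ) * ∑ n ∈ Finset.Icc 1 N, ‖c n‖ ^ lam ≤ B := hB ⟨N, rfl⟩
  have h1 : ∀ n ∈ Finset.Icc 1 N, ‖c n‖ ≤ ‖c n‖ ^ lam + 1 := by
    intro n _
    rcases le_total 1 ‖c n‖ with h | h
    · have := Real.self_le_rpow_of_one_le h hl.le
      linarith
    · have : 0 ≤ ‖c n‖ ^ lam := by positivity
      linarith
  have h2 := mul_le_mul_of_nonneg_left (Finset.sum_le_sum h1) (by positivity : (0:ℝ) ≤ 1 / N)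
  rw [Finset.sum_add_distrib, mul_add] at h2
  have h3 : (1 / N : ℝ) * ∑ n ∈ Finset.Icc 1 N, (1:ℝ) ≤ 1 := by
    simp only [Finset.sum_const, Nat.card_Icc, nsmul_eq_mul, mul_one, Nat.add_sub_cancel]
    rw [one_div]
    exact inv_mul_le_one
  have := le_max_left B 0
  linarith

lemma disjoint_aux (c : ℕ → ℂ) (hc : HigherOrderOscillating c 2)
    (A : Matrix (Fin 2) (Fin 2) ℤ) (hA : (A ^ 12 - 1) ^ 2 = 0) (a : Torus 2) :
    LinearlyDisjoint c (torusAffine A a) := by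
  intro f hf x
  obtain ⟨M, hM, hMb⟩ := bdd_aux c hc
  have hspan : ∀ p ∈ Submodule.span ℂ (Set.range (UnitAddTorus.mFourier (d := Fin 2))),
      AvgZero c (fun n => p ((torusAffine A a)^[n] x)) := by
    intro p hp
    induction hp using Submodule.span_induction with
    | mem p hp => obtain ⟨k, rfl⟩ := hp; exact char_avg c hc A hA a x k
    | zero => simpa using AvgZero.zero
    | add p q _ _ h1 h2 => exact h1.add h2
    | smul k p _ h => exact h.const_mul k
  have hmem : (⟨f, hf⟩ : C(UnitAddTorus (Fin 2), ℂ)) ∈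
      closure (Submodule.span ℂ (Set.range (UnitAddTorus.mFourier (d := Fin 2))) : Set C(UnitAddTorus (Fin 2), ℂ)) := by
    rw [← Submodule.topologicalClosure_coe, UnitAddTorus.span_mFourier_closure_eq_top]
    trivial
  rw [Metric.tendsto_atTop]
  intro ε hε
  obtain ⟨p, hp, hpf⟩ := Metric.mem_closure_iff.1 hmem (ε / (2 * M)) (by positivity)
  obtain ⟨N0, hN0⟩ := Metric.tendsto_atTop.1 (hspan p hp) (ε / 2) (by positivity)
  refine ⟨N0, fun N hN => ?_⟩
  have h1 := hN0 N hN
  rw [dist_zero_right] at h1 ⊢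
  have h2 : ‖(1 / N : ℂ) * ∑ n ∈ Finset.Icc 1 N, c n * (f ((torusAffine A a)^[n] x) - p ((torusAffine A a)^[n] x))‖ ≤ ε / 2 := by
    rw [norm_mul]
    have h3 : ‖∑ n ∈ Finset.Icc 1 N, c n * (f ((torusAffine A a)^[n] x) - p ((torusAffine A a)^[n] x))‖
        ≤ (∑ n ∈ Finset.Icc 1 N, ‖c n‖) * (ε / (2 * M)) := by
      rw [Finset.sum_mul]
      refine norm_sum_le_of_le _ fun n _ => ?_
      rw [norm_mul]
      gcongr
      rw [← dist_eq_norm]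
      exact (ContinuousMap.dist_apply_le_dist (f := (⟨f, hf⟩ : C(UnitAddTorus (Fin 2), ℂ))) (g := p) _).trans hpf.le
    have h4 : ‖(1 / N : ℂ)‖ = 1 / N := by simp
    rw [h4]
    calc (1 / N : ℝ) * _ ≤ (1 / N : ℝ) * ((∑ n ∈ Finset.Icc 1 N, ‖c n‖) * (ε / (2 * M))) := by gcongr
      _ = ((1 / N : ℝ) * (∑ n ∈ Finset.Icc 1 N, ‖c n‖)) * (ε / (2 * M)) := by ring
      _ ≤ M * (ε / (2 * M)) := by gcongr; exact hMb N
      _ = ε / 2 := by field_simp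
  have h5 : (1 / N : ℂ) * ∑ n ∈ Finset.Icc 1 N, c n * f ((torusAffine A a)^[n] x) =
      (1 / N : ℂ) * ∑ n ∈ Finset.Icc 1 N, c n * (f ((torusAffine A a)^[n] x) - p ((torusAffine A a)^[n] x))
      + (1 / N : ℂ) * ∑ n ∈ Finset.Icc 1 N, c n * p ((torusAffine A a)^[n] x) := by
    rw [← mul_add, ← Finset.sum_add_distrib]
    congr 1
    exact Finset.sum_congr rfl fun n _ => by ring
  rw [h5]
  refine (norm_add_le _ _).trans_lt ?_
  linarith

/-- Any higher order oscillating sequence of order 2 (stronger version) is linearly disjoint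
from every affine flow `T x = A x + a` on the 2-torus (`A ∈ GL(2,ℤ)`) with zero topological
entropy. -/
theorem higherOrderOscillating_linearlyDisjoint_affine_torus2_of_entropy_zero
    (c : ℕ → ℂ) (hc : HigherOrderOscillating c 2)
    (A : Matrix (Fin 2) (Fin 2) ℤ) (hA : IsUnit A.det) (a : Torus 2)
    (hEnt : Dynamics.coverEntropy (torusAffine A a) Set.univ = 0) :
    LinearlyDisjoint c (torusAffine A a) := by
  exact disjoint_aux c hc A (char_of_entropy A hA a hEnt) a
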